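/- For all n ≥ 0, g(n+1) = Σ_{k=0}^{⌊(n−2)/2⌋} C(n,2k)·f(2k)·(f(n−2k) − g(n−2k)) + f(n) if n is even, and g(n+1) = Σ_{k=0}^{⌊(n−2)/2⌋} C(n,2k)·f(2k)·(f(n−2k) − g(n−2k)) + g(n) if n is odd (the sum is empty when n ≤ 1). -/

import Mathlib

/-- The entry of the permutation `σ` of `[n]` at (1-based) position `i`,
as a value in `{1, …, n}`; `0` if `i` is out of range. -/
def permEnt {n : ℕ} (σ : Equiv.Perm (Fin n)) (i : ℕ) : ℕ :=
  if h : 1 ≤ i ∧ i ≤ n then (σ ⟨i - 1, by omega⟩ : ℕ) + 1 else 0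

/-- `i` is a descent of `σ`: `1 ≤ i ≤ n−1` and `π_i > π_{i+1}`. -/
def IsDescent {n : ℕ} (σ : Equiv.Perm (Fin n)) (i : ℕ) : Prop :=
  1 ≤ i ∧ i < n ∧ permEnt σ (i + 1) < permEnt σ i

/-- `i` is an alternating descent of `σ`: `i` odd with `π_i > π_{i+1}`,
or `i` even with `π_i < π_{i+1}`. -/
def IsAltDescent {n : ℕ} (σ : Equiv.Perm (Fin n)) (i : ℕ) : Prop :=
  1 ≤ i ∧ i < n ∧
    ((i % 2 = 1 ∧ permEnt σ (i + 1) < permEnt σ i) ∨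
     (i % 2 = 0 ∧ permEnt σ i < permEnt σ (i + 1)))

instance {n : ℕ} (σ : Equiv.Perm (Fin n)) (i : ℕ) : Decidable (IsDescent σ i) := by
  unfold IsDescent; infer_instance

instance {n : ℕ} (σ : Equiv.Perm (Fin n)) (i : ℕ) : Decidable (IsAltDescent σ i) := by
  unfold IsAltDescent; infer_instance

/-- `i` is a peak of `σ`: `2 ≤ i ≤ n−1` and `π_{i−1} < π_i > π_{i+1}`. -/
def IsPeak {n : ℕ} (σ : Equiv.Perm (Fin n)) (i : ℕ) : Prop :=
  2 ≤ i ∧ i < n ∧ permEnt σ (i - 1) < permEnt σ i ∧ permEnt σ (i + 1) < permEnt σ i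

/-- `i` is a valley of `σ`: `2 ≤ i ≤ n−1` and `π_{i−1} > π_i < π_{i+1}`. -/
def IsValley {n : ℕ} (σ : Equiv.Perm (Fin n)) (i : ℕ) : Prop :=
  2 ≤ i ∧ i < n ∧ permEnt σ i < permEnt σ (i - 1) ∧ permEnt σ i < permEnt σ (i + 1)

/-- All valleys of `σ` are even and all peaks of `σ` are odd. -/
def GoodPerm {n : ℕ} (σ : Equiv.Perm (Fin n)) : Prop :=
  (∀ i, IsValley σ i → i % 2 = 0) ∧ (∀ i, IsPeak σ i → i % 2 = 1)

/-- `f n` is the number of permutations of `[n]` with all valleys even and all peaks odd. -/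
noncomputable def fCount (n : ℕ) : ℕ :=
  Nat.card {σ : Equiv.Perm (Fin n) // GoodPerm σ}

/-- `g n` is the number of permutations of `[n]` with all valleys even and all peaks odd
having no descent at position `n − 1`. -/
noncomputable def gCount (n : ℕ) : ℕ :=
  Nat.card {σ : Equiv.Perm (Fin n) // GoodPerm σ ∧ ¬ IsDescent σ (n - 1)}

/-- `σ` is an alternating permutation: `π₁ > π₂ < π₃ > π₄ < ⋯`. -/
def IsAltPerm {n : ℕ} (σ : Equiv.Perm (Fin n)) : Prop :=
  ∀ i, 1 ≤ i → i < n →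
    (i % 2 = 1 → permEnt σ (i + 1) < permEnt σ i) ∧
    (i % 2 = 0 → permEnt σ i < permEnt σ (i + 1))

/-- The Euler number `Eₙ`, the number of alternating permutations of `[n]`. -/
noncomputable def eulerNum (n : ℕ) : ℕ :=
  Nat.card {σ : Equiv.Perm (Fin n) // IsAltPerm σ}

/-- Peak/valley parity condition for a word given as a function on `ℕ`. -/
def GoodW (n : ℕ) (W : ℕ → ℕ) : Prop :=
  ∀ i, 2 ≤ i → i < n → (W i < W (i-1) → W i < W (i+1) → i % 2 = 0) ∧
    (W (i-1) < W i → W (i+1) < W i → i % 2 = 1)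

theorem goodPerm_iff {n : ℕ} (σ : Equiv.Perm (Fin n)) : GoodPerm σ ↔ GoodW n (permEnt σ) := by
  unfold GoodPerm GoodW IsPeak IsValley
  constructor
  · rintro ⟨h1, h2⟩ i hi hn
    exact ⟨fun a b => h1 i ⟨hi, hn, a, b⟩, fun a b => h2 i ⟨hi, hn, a, b⟩⟩
  · intro h
    exact ⟨fun i ⟨hi, hn, a, b⟩ => (h i hi hn).1 a b, fun i ⟨hi, hn, a, b⟩ => (h i hi hn).2 a b⟩

theorem word_last (n : ℕ) (W A : ℕ → ℕ)
    (hA : ∀ i i', 1 ≤ i → i ≤ n → 1 ≤ i' → i' ≤ n → (W i < W i' ↔ A i < A i'))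
    (hM : ∀ i, 1 ≤ i → i ≤ n + 1 → i ≠ n + 1 → W i < W (n + 1)) :
    (GoodW (n+1) W ∧ ¬ (1 ≤ n ∧ n < n + 1 ∧ W (n+1) < W n)) ↔
      (GoodW n A ∧ (¬ Even n → ¬ (1 ≤ n - 1 ∧ n - 1 < n ∧ A (n - 1 + 1) < A (n - 1)))) := by
  constructor
  · rintro ⟨h1, h2⟩
    refine ⟨?_, ?_⟩
    · intro i hi hn
      have := h1 i hi (by omega)
      rw [hA i (i-1) (by omega) (by omega) (by omega) (by omega),
        hA i (i+1) (by omega) (by omega) (by omega) (by omega),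
        hA (i-1) i (by omega) (by omega) (by omega) (by omega),
        hA (i+1) i (by omega) (by omega) (by omega) (by omega)] at this
      exact this
    · rintro hn ⟨h3, h4, h5⟩
      have := (h1 n (by omega) (by omega)).1
      rw [hA n (n-1) (by omega) (by omega) (by omega) (by omega)] at this
      rw [show n - 1 + 1 = n by omega] at h5
      have := this h5 (hM n (by omega) (by omega) (by omega))
      rw [Nat.even_iff] at hn
      exact hn this
  · rintro ⟨h1, h2⟩
    refine ⟨?_, ?_⟩
    · intro i hi hn
      rcases Nat.lt_or_ge i n with h | h
      · have := h1 i hi h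
        rw [← hA i (i-1) (by omega) (by omega) (by omega) (by omega),
          ← hA i (i+1) (by omega) (by omega) (by omega) (by omega),
          ← hA (i-1) i (by omega) (by omega) (by omega) (by omega),
          ← hA (i+1) i (by omega) (by omega) (by omega) (by omega)] at this
        exact this
      · obtain rfl : i = n := by omega
        have hm := hM i (by omega) (by omega) (by omega)
        refine ⟨fun a b => ?_, fun a b => by omega⟩
        rw [hA i (i-1) (by omega) (by omega) (by omega) (by omega)] at a
        by_contra hc
        refine h2 (by rwa [Nat.even_iff]) ⟨by omega, by omega, ?_⟩
        rwa [show i - 1 + 1 = i by omega]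
    · rintro ⟨a, b, c⟩
      have hm := hM n (by omega) (by omega) (by omega)
      omega

theorem word_mid (n j m : ℕ) (hm : 1 ≤ m) (hn : n = j + m) (W A B : ℕ → ℕ)
    (hA : ∀ i i', 1 ≤ i → i ≤ j → 1 ≤ i' → i' ≤ j → (W i < W i' ↔ A i < A i'))
    (hB : ∀ i i', 1 ≤ i → i ≤ m → 1 ≤ i' → i' ≤ m → (W (j+1+i) < W (j+1+i') ↔ B i' < B i))
    (hBi : ∀ i i', 1 ≤ i → i ≤ m → 1 ≤ i' → i' ≤ m → B i = B i' → i = i')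
    (hM : ∀ i, 1 ≤ i → i ≤ n + 1 → i ≠ j + 1 → W i < W (j + 1)) :
    (GoodW (n+1) W ∧ ¬ (1 ≤ n ∧ n < n + 1 ∧ W (n+1) < W n)) ↔
      (Even j ∧ GoodW j A ∧ GoodW m B ∧ (1 ≤ m - 1 ∧ m - 1 < m ∧ B (m - 1 + 1) < B (m - 1))) := by
  subst hn
  constructor
  · rintro ⟨h1, h2⟩
    have hm2 : 2 ≤ m := by
      by_contra hc
      obtain rfl : m = 1 := by omega
      exact h2 ⟨by omega, by omega, hM (j+1+1) (by omega) (by omega) (by omega)⟩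
    have hj : Even j := by
      rcases Nat.eq_zero_or_pos j with h | h
      · simp [h]
      · have := (h1 (j+1) (by omega) (by omega)).2 (hM _ (by omega) (by omega) (by omega))
          (hM _ (by omega) (by omega) (by omega))
        rw [Nat.even_iff]; omega
    refine ⟨hj, ?_, ?_, by omega, by omega, ?_⟩
    · intro i hi hn
      have := h1 i hi (by omega)
      rw [hA i (i-1) (by omega) (by omega) (by omega) (by omega),
        hA i (i+1) (by omega) (by omega) (by omega) (by omega),
        hA (i-1) i (by omega) (by omega) (by omega) (by omega),
        hA (i+1) i (by omega) (by omega) (by omega) (by omega)] at this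
      exact this
    · intro i hi hn
      have := h1 (j+1+i) (by omega) (by omega)
      rw [show j+1+i-1 = j+1+(i-1) by omega, add_assoc (j+1) i 1,
        hB i (i-1) (by omega) (by omega) (by omega) (by omega),
        hB i (i+1) (by omega) (by omega) (by omega) (by omega),
        hB (i-1) i (by omega) (by omega) (by omega) (by omega),
        hB (i+1) i (by omega) (by omega) (by omega) (by omega)] at this
      rw [Nat.even_iff] at hj
      refine ⟨fun a b => ?_, fun a b => ?_⟩
      · have := this.2 a b; omega
      · have := this.1 a b; omega
    · have h3 : ¬ W (j + m + 1) < W (j + m) := fun h => h2 ⟨by omega, by omega, h⟩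
      rw [show j + m + 1 = j + 1 + m by omega, show j + m = j + 1 + (m-1) by omega,
        hB m (m-1) (by omega) (by omega) (by omega) (by omega)] at h3
      have h4 : B (m-1) ≠ B m := fun h => by
        have := hBi (m-1) m (by omega) (by omega) (by omega) (by omega) h
        omega
      rw [show m - 1 + 1 = m by omega]
      omega
  · rintro ⟨hj, h1, h2, h3, h4, h5⟩
    rw [Nat.even_iff] at hj
    refine ⟨?_, ?_⟩
    · intro i hi hn
      rcases lt_trichotomy i (j+1) with h | h | h
      · rcases Nat.lt_or_ge i j with h' | h'
        · have := h1 i hi h'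
          rw [← hA i (i-1) (by omega) (by omega) (by omega) (by omega),
            ← hA i (i+1) (by omega) (by omega) (by omega) (by omega),
            ← hA (i-1) i (by omega) (by omega) (by omega) (by omega),
            ← hA (i+1) i (by omega) (by omega) (by omega) (by omega)] at this
          exact this
        · obtain rfl : i = j := by omega
          have := hM i (by omega) (by omega) (by omega)
          exact ⟨fun a b => hj, fun a b => by omega⟩
      · subst h
        have := hM (j+1+1) (by omega) (by omega) (by omega)
        exact ⟨fun a b => by omega, fun a b => by omega⟩
      · rcases Nat.lt_or_ge (j+2) i with h' | h'
        · obtain ⟨t, rfl⟩ : ∃ t, i = j + 1 + t := ⟨i - (j+1), by omega⟩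
          have := h2 t (by omega) (by omega)
          rw [← hB (t-1) t (by omega) (by omega) (by omega) (by omega),
            ← hB (t+1) t (by omega) (by omega) (by omega) (by omega),
            ← hB t (t-1) (by omega) (by omega) (by omega) (by omega),
            ← hB t (t+1) (by omega) (by omega) (by omega) (by omega)] at this
          rw [show j+1+t-1 = j+1+(t-1) by omega, add_assoc (j+1) t 1]
          refine ⟨fun a b => ?_, fun a b => ?_⟩
          · have := this.2 a b; omega
          · have := this.1 a b; omega
        · obtain rfl : i = j + 1 + 1 := by omega
          have := hM (j+1+1) (by omega) (by omega) (by omega)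
          refine ⟨fun a b => by omega, fun a b => ?_⟩
          rw [show j + 1 + 1 - 1 = j + 1 by omega] at a
          omega
    · rintro ⟨a, b, c⟩
      rw [show j + m + 1 = j + 1 + m by omega, show j + m = j + 1 + (m-1) by omega,
        hB m (m-1) (by omega) (by omega) (by omega) (by omega)] at c
      rw [show m - 1 + 1 = m by omega] at h5
      omega

theorem compl_card {n j : ℕ} (S : Finset (Fin n)) (h : S.card = j) : Sᶜ.card = n - j := by
  rw [Finset.card_compl, h, Fintype.card_fin]

/-- The data of a permutation of `[n+1]` whose maximum is in (0-based) position `j`. -/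
abbrev Dat (n j : ℕ) : Type :=
  {S : Finset (Fin n) // S.card = j} × Equiv.Perm (Fin j) × Equiv.Perm (Fin (n - j))

/-- The word: left part on `S`, maximum, reversed-pattern right part on the complement. -/
def glue {n j : ℕ} (d : Dat n j) (i : Fin (n + 1)) : Fin (n + 1) :=
  if h : i.1 < j then Fin.castSucc (d.1.1.orderEmbOfFin d.1.2 (d.2.1 ⟨i.1, h⟩))
  else if h' : i.1 = j then Fin.last n
  else Fin.castSucc (d.1.1ᶜ.orderEmbOfFin (compl_card d.1.1 d.1.2)
    (Fin.rev (d.2.2 ⟨i.1 - (j + 1), by omega⟩)))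

theorem glue_left {n j : ℕ} (d : Dat n j) (i : ℕ) (hi : i < n + 1) (h : i < j) :
    glue d ⟨i, hi⟩ = Fin.castSucc (d.1.1.orderEmbOfFin d.1.2 (d.2.1 ⟨i, h⟩)) := by
  simp [glue, h]

theorem glue_mid {n j : ℕ} (d : Dat n j) (hj : j < n + 1) :
    glue d ⟨j, hj⟩ = Fin.last n := by
  simp [glue]

theorem glue_right {n j : ℕ} (d : Dat n j) (i : ℕ) (hi : j + 1 + i < n + 1) :
    glue d ⟨j + 1 + i, hi⟩ = Fin.castSucc (d.1.1ᶜ.orderEmbOfFin (compl_card d.1.1 d.1.2)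
      (Fin.rev (d.2.2 ⟨i, by omega⟩))) := by
  unfold glue
  rw [dif_neg (by simp; omega), dif_neg (by simp; omega)]
  simp

theorem pos_cases (j i : ℕ) : i < j ∨ i = j ∨ ∃ t, i = j + 1 + t := by
  rcases lt_trichotomy i j with h | h | h
  · exact Or.inl h
  · exact Or.inr (Or.inl h)
  · exact Or.inr (Or.inr ⟨i - (j+1), by omega⟩)

theorem glue_injective {n j : ℕ} (d : Dat n j) : Function.Injective (glue d) := by
  have key : ∀ a b, d.1.1.orderEmbOfFin d.1.2 a ≠
      d.1.1ᶜ.orderEmbOfFin (compl_card d.1.1 d.1.2) b := by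
    intro a b h
    have h1 := Finset.orderEmbOfFin_mem d.1.1 d.1.2 a
    have h2 := Finset.orderEmbOfFin_mem d.1.1ᶜ (compl_card d.1.1 d.1.2) b
    rw [← h, Finset.mem_compl] at h2
    exact h2 h1
  rintro ⟨a, ha⟩ ⟨b, hb⟩ h
  rcases pos_cases j a with h1 | h0 | ⟨t, rfl⟩ <;> rcases pos_cases j b with h2 | h2 | ⟨u, rfl⟩
  · rw [glue_left d a ha h1, glue_left d b hb h2] at h
    simpa using h
  · subst h2
    rw [glue_left d a ha h1, glue_mid] at h
    exact absurd h (Fin.castSucc_ne_last _)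
  · rw [glue_left d a ha h1, glue_right] at h
    exact absurd (Fin.castSucc_injective _ h) (key _ _)
  · subst h0
    rw [glue_left d b hb h2, glue_mid] at h
    exact absurd h.symm (Fin.castSucc_ne_last _)
  · subst h0; subst h2; rfl
  · subst h0
    rw [glue_mid, glue_right] at h
    exact absurd h.symm (Fin.castSucc_ne_last _)
  · rw [glue_left d b hb h2, glue_right] at h
    exact absurd (Fin.castSucc_injective _ h).symm (key _ _)
  · subst h2
    rw [glue_mid, glue_right] at h
    exact absurd h (Fin.castSucc_ne_last _)
  · rw [glue_right, glue_right] at h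
    have := Fin.castSucc_injective _ h
    simp at this
    simp [this]

/-- The glued permutation. -/
noncomputable def gluePerm {n : ℕ} (x : Σ j : Fin (n + 1), Dat n j) : Equiv.Perm (Fin (n + 1)) :=
  Equiv.ofBijective (glue x.2) (Finite.injective_iff_bijective.mp (glue_injective x.2))

theorem gluePerm_apply {n : ℕ} (x : Σ j : Fin (n + 1), Dat n j) (i) :
    gluePerm x i = glue x.2 i := rfl

theorem gluePerm_injective (n : ℕ) : Function.Injective (gluePerm (n := n)) := by
  rintro ⟨⟨j, hj⟩, d⟩ ⟨⟨j', hj'⟩, d'⟩ h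
  have hg : ∀ i, glue d i = glue d' i := fun i => by
    have := congrArg (fun e => e i) h
    simpa [gluePerm_apply] using this
  obtain rfl : j = j' := by
    have h1 := hg ⟨j, hj⟩
    rw [glue_mid d hj, ← glue_mid d' hj'] at h1
    have := glue_injective d' h1
    simpa using this.symm
  congr 1
  obtain ⟨⟨S, hS⟩, α, β⟩ := d
  obtain ⟨⟨S', hS'⟩, α', β'⟩ := d'
  have hsub : ∀ i : Fin j, S.orderEmbOfFin hS (α i) = S'.orderEmbOfFin hS' (α' i) := by
    intro i
    have := hg ⟨i, by omega⟩
    rw [glue_left _ _ _ i.2, glue_left _ _ _ i.2] at this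
    exact Fin.castSucc_injective _ this
  obtain rfl : S = S' := by
    apply Finset.eq_of_subset_of_card_le
    · intro x hx
      have : x ∈ Set.range (S.orderEmbOfFin hS) := by simpa using hx
      obtain ⟨y, rfl⟩ := this
      obtain ⟨i, rfl⟩ := α.surjective y
      rw [hsub]
      exact Finset.orderEmbOfFin_mem _ _ _
    · omega
  obtain rfl : α = α' := by
    ext1 i
    simpa using hsub i
  obtain rfl : β = β' := by
    ext1 i
    have hi : i.1 < n - j := i.2
    have := hg ⟨j + 1 + i, by omega⟩
    rw [glue_right, glue_right] at this
    simpa using this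
  rfl

theorem card_dat (n j : ℕ) (hj : j ≤ n) : Fintype.card (Dat n j) = n.factorial := by
  simp only [Dat, Fintype.card_prod, Fintype.card_perm, Fintype.card_fin,
    Fintype.card_finset_len]
  rw [← mul_assoc, Nat.choose_mul_factorial_mul_factorial hj]

theorem gluePerm_bijective (n : ℕ) : Function.Bijective (gluePerm (n := n)) := by
  rw [Fintype.bijective_iff_injective_and_card]
  refine ⟨gluePerm_injective n, ?_⟩
  rw [Fintype.card_sigma, Fintype.card_perm, Fintype.card_fin,
    Finset.sum_congr rfl (fun (j : Fin (n+1)) _ => card_dat n j.1 (by omega))]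
  simp [Nat.factorial_succ]

theorem permEnt_of {n : ℕ} (σ : Equiv.Perm (Fin n)) (i : ℕ) (hi : 1 ≤ i) (h : i ≤ n) :
    permEnt σ i = (σ ⟨i - 1, by omega⟩ : ℕ) + 1 := by
  unfold permEnt
  rw [dif_pos ⟨hi, h⟩]

theorem ent_left {n : ℕ} (j : Fin (n+1)) (d : Dat n j) (i i' : ℕ) (h1 : 1 ≤ i) (h2 : i ≤ j.1)
    (h3 : 1 ≤ i') (h4 : i' ≤ j.1) :
    permEnt (gluePerm ⟨j, d⟩) i < permEnt (gluePerm ⟨j, d⟩) i' ↔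
      permEnt d.2.1 i < permEnt d.2.1 i' := by
  rw [permEnt_of _ i h1 (by omega), permEnt_of _ i' h3 (by omega),
    permEnt_of _ i h1 (by omega), permEnt_of _ i' h3 (by omega),
    gluePerm_apply, gluePerm_apply, glue_left d (i-1) _ (by omega), glue_left d (i'-1) _ (by omega)]
  simp

theorem ent_right {n : ℕ} (j : Fin (n+1)) (d : Dat n j) (i i' : ℕ) (h1 : 1 ≤ i) (h2 : i ≤ n - j.1)
    (h3 : 1 ≤ i') (h4 : i' ≤ n - j.1) :
    permEnt (gluePerm ⟨j, d⟩) (j.1 + 1 + i) < permEnt (gluePerm ⟨j, d⟩) (j.1 + 1 + i') ↔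
      permEnt d.2.2 i' < permEnt d.2.2 i := by
  rw [permEnt_of _ (j.1 + 1 + i) (by omega) (by omega),
    permEnt_of _ (j.1 + 1 + i') (by omega) (by omega),
    permEnt_of _ i h1 (by omega), permEnt_of _ i' h3 (by omega),
    gluePerm_apply, gluePerm_apply]
  have e1 : (⟨j.1 + 1 + i - 1, by omega⟩ : Fin (n+1)) = ⟨j.1 + 1 + (i - 1), by omega⟩ := by
    ext; simp; omega
  have e2 : (⟨j.1 + 1 + i' - 1, by omega⟩ : Fin (n+1)) = ⟨j.1 + 1 + (i' - 1), by omega⟩ := by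
    ext; simp; omega
  rw [e1, e2, glue_right, glue_right]
  simp

theorem ent_max {n : ℕ} (j : Fin (n+1)) (d : Dat n j) (i : ℕ) (h1 : 1 ≤ i) (h2 : i ≤ n + 1)
    (h3 : i ≠ j.1 + 1) :
    permEnt (gluePerm ⟨j, d⟩) i < permEnt (gluePerm ⟨j, d⟩) (j.1 + 1) := by
  have hne : gluePerm ⟨j, d⟩ ⟨i - 1, by omega⟩ ≠ Fin.last n := by
    rw [← glue_mid d j.2, ← gluePerm_apply ⟨j, d⟩]
    intro h
    have := congrArg Fin.val ((gluePerm ⟨j, d⟩).injective h)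
    dsimp only at this
    omega
  have hl : gluePerm ⟨j, d⟩ ⟨j.1 + 1 - 1, by omega⟩ = Fin.last n := glue_mid d j.2
  rw [permEnt_of _ i h1 (by omega), permEnt_of _ (j.1+1) (by omega) (by omega), hl]
  have := Fin.lt_last_iff_ne_last.mpr hne
  rw [Fin.lt_def] at this
  omega

theorem permEnt_inj {n : ℕ} (σ : Equiv.Perm (Fin n)) (i i' : ℕ) (h1 : 1 ≤ i) (h2 : i ≤ n)
    (h3 : 1 ≤ i') (h4 : i' ≤ n) (h : permEnt σ i = permEnt σ i') : i = i' := by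
  rw [permEnt_of _ i h1 (by omega), permEnt_of _ i' h3 (by omega)] at h
  have := σ.injective (Fin.ext (Nat.succ_injective h))
  simp at this
  omega

/-- The event counted by `gCount`. -/
def GProp {n : ℕ} (σ : Equiv.Perm (Fin n)) : Prop := GoodPerm σ ∧ ¬ IsDescent σ (n - 1)

theorem glue_prop_last {n : ℕ} (j : Fin (n+1)) (hj : j.1 = n) (d : Dat n j) :
    GProp (gluePerm ⟨j, d⟩) ↔
      (GoodPerm d.2.1 ∧ (¬ Even n → ¬ IsDescent d.2.1 (j.1 - 1))) := by
  obtain ⟨j, hjn⟩ := j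
  dsimp only at hj
  subst hj
  unfold GProp IsDescent
  rw [goodPerm_iff, goodPerm_iff]
  exact word_last j _ _ (fun i i' => ent_left ⟨j, hjn⟩ d i i') (fun i => ent_max ⟨j, hjn⟩ d i)

theorem glue_prop_mid {n : ℕ} (j : Fin (n+1)) (hj : j.1 < n) (d : Dat n j) :
    GProp (gluePerm ⟨j, d⟩) ↔
      (Even j.1 ∧ GoodPerm d.2.1 ∧ GoodPerm d.2.2 ∧ IsDescent d.2.2 (n - j.1 - 1)) := by
  unfold GProp IsDescent
  rw [goodPerm_iff, goodPerm_iff, goodPerm_iff]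
  exact word_mid n j (n - j) (by omega) (by omega) _ _ _ (fun i i' => ent_left j d i i')
    (fun i i' => ent_right j d i i') (fun i i' => permEnt_inj d.2.2 i i')
    (fun i => ent_max j d i)

/-- Number of good permutations of `[n]` with a descent at `n-1`. -/
noncomputable def hCount (n : ℕ) : ℕ :=
  Nat.card {σ : Equiv.Perm (Fin n) // GoodPerm σ ∧ IsDescent σ (n - 1)}

theorem f_eq (n : ℕ) : fCount n = gCount n + hCount n := by
  classical
  unfold fCount gCount hCount
  simp only [Nat.card_eq_fintype_card, Fintype.card_subtype]
  rw [← Finset.card_filter_add_card_filter_not (s := {σ : Equiv.Perm (Fin n) | GoodPerm σ})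
    (fun σ => IsDescent σ (n - 1)), Finset.filter_filter, Finset.filter_filter, add_comm]

theorem card_dat_sub (n j : ℕ) (P : Equiv.Perm (Fin j) → Prop) (Q : Equiv.Perm (Fin (n - j)) → Prop) :
    Nat.card {d : Dat n j // P d.2.1 ∧ Q d.2.2} =
      n.choose j * Nat.card {σ // P σ} * Nat.card {σ // Q σ} := by
  have e : {d : Dat n j // P d.2.1 ∧ Q d.2.2} ≃
      {S : Finset (Fin n) // S.card = j} × {σ // P σ} × {σ // Q σ} :=
    { toFun := fun d => ⟨d.1.1, ⟨d.1.2.1, d.2.1⟩, ⟨d.1.2.2, d.2.2⟩⟩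
      invFun := fun x => ⟨⟨x.1, x.2.1.1, x.2.2.1⟩, x.2.1.2, x.2.2.2⟩
      left_inv := fun _ => rfl
      right_inv := fun _ => rfl }
  rw [Nat.card_congr e, Nat.card_prod, Nat.card_prod, mul_assoc]
  congr 1
  rw [Nat.card_eq_fintype_card, Fintype.card_finset_len, Fintype.card_fin]

theorem g_sum (n : ℕ) : gCount (n + 1) =
    ∑ j : Fin (n + 1), Nat.card {d : Dat n j // GProp (gluePerm ⟨j, d⟩)} := by
  rw [← Nat.card_sigma]
  symm
  have e1 : (Σ j : Fin (n+1), {d : Dat n j // GProp (gluePerm ⟨j, d⟩)}) ≃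
      {x : Σ j : Fin (n+1), Dat n j // GProp (gluePerm x)} :=
    { toFun := fun x => ⟨⟨x.1, x.2.1⟩, x.2.2⟩
      invFun := fun x => ⟨x.1.1, ⟨x.1.2, x.2⟩⟩
      left_inv := fun _ => rfl
      right_inv := fun _ => rfl }
  rw [Nat.card_congr e1]
  exact Nat.card_congr ((Equiv.ofBijective _ (gluePerm_bijective n)).subtypeEquiv (fun _ => Iff.rfl))

theorem term_mid (n : ℕ) (j : Fin (n+1)) (hj : j.1 < n) :
    Nat.card {d : Dat n j // GProp (gluePerm ⟨j, d⟩)} =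
      if Even j.1 then n.choose j * fCount j * hCount (n - j) else 0 := by
  split_ifs with h
  · unfold fCount hCount
    rw [← card_dat_sub n j GoodPerm (fun σ => GoodPerm σ ∧ IsDescent σ (n - j - 1))]
    refine Nat.card_congr (Equiv.subtypeEquivRight fun d => ?_)
    rw [glue_prop_mid j hj]
    tauto
  · rw [Nat.card_eq_zero]
    left
    constructor
    rintro ⟨d, hd⟩
    exact h ((glue_prop_mid j hj d).1 hd).1

theorem term_last (n : ℕ) :
    Nat.card {d : Dat n (Fin.last n) // GProp (gluePerm ⟨Fin.last n, d⟩)} =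
      if Even n then fCount n else gCount n := by
  have h1 : Nat.card {σ : Equiv.Perm (Fin (n - n)) // True} = 1 := by
    rw [Nat.card_eq_fintype_card, Fintype.card_subtype_true, Fintype.card_perm]
    simp
  have := card_dat_sub n n (fun σ => GoodPerm σ ∧ (¬ Even n → ¬ IsDescent σ (n - 1)))
    (fun _ => True)
  rw [h1, Nat.choose_self, one_mul, mul_one] at this
  rw [Nat.card_congr (Equiv.subtypeEquivRight fun d => glue_prop_last (Fin.last n) rfl d)]
  refine Eq.trans (Nat.card_congr (Equiv.subtypeEquivRight fun d => ?_)) (this.trans ?_)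
  · simp only [and_true]; rfl
  · unfold fCount gCount
    split_ifs with h <;> simp [h]

theorem h_one : hCount 1 = 0 := by
  unfold hCount
  rw [Nat.card_eq_zero]
  left
  constructor
  rintro ⟨d, hd⟩
  have := hd.2.1
  omega

theorem sum_even (n : ℕ) (F : ℕ → ℕ) (hF : ∀ k, n = 2 * k + 1 → F (2 * k) = 0) :
    ∑ j ∈ Finset.range n, (if Even j then F j else 0) = ∑ k ∈ Finset.range (n / 2), F (2 * k) := by
  have key : ∀ m, ∑ j ∈ Finset.range (2 * m), (if Even j then F j else 0) =
      ∑ k ∈ Finset.range m, F (2 * k) := by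
    intro m
    induction m with
    | zero => simp
    | succ m ih =>
      rw [show 2 * (m + 1) = 2 * m + 1 + 1 by ring, Finset.sum_range_succ, Finset.sum_range_succ,
        ih, Finset.sum_range_succ]
      simp
  rcases Nat.even_or_odd' n with ⟨k, rfl | rfl⟩
  · rw [key]; congr 2; omega
  · rw [Finset.sum_range_succ, key, hF k rfl]
    have : (2 * k + 1) / 2 = k := by omega
    simp [this]

/-- the recurrence for `g`. -/
theorem statement2 (n : ℕ) :
    (gCount (n + 1) : ℤ) =
      (∑ k ∈ Finset.range (n / 2),
        (n.choose (2 * k) : ℤ) * fCount (2 * k) *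
          ((fCount (n - 2 * k) : ℤ) - gCount (n - 2 * k))) +
      (if Even n then (fCount n : ℤ) else (gCount n : ℤ)) := by
  have hs : gCount (n + 1) = (∑ k ∈ Finset.range (n / 2),
      n.choose (2 * k) * fCount (2 * k) * hCount (n - 2 * k)) +
      (if Even n then fCount n else gCount n) := by
    rw [g_sum, Fin.sum_univ_castSucc, term_last]
    congr 1
    rw [Finset.sum_congr rfl (fun j _ => term_mid n (Fin.castSucc j) j.2)]
    rw [← sum_even n (fun j => n.choose j * fCount j * hCount (n - j)), ← Fin.sum_univ_eq_sum_range
      (fun j => if Even j then n.choose j * fCount j * hCount (n - j) else 0)]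
    · rfl
    · rintro k rfl
      simp [h_one]
  have hh : ∀ m, (fCount m : ℤ) - gCount m = hCount m := by
    intro m
    rw [f_eq m]
    push_cast
    ring
  simp only [hh]
  rw [hs]
  push_cast
  rfl
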